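/- Let g be a complex semisimple Lie algebra and let V, W be finite-dimensional representations of g such that W is irreducible and all weight spaces of V are one-dimensional. Then the tensor product V ⊗ W decomposes into irreducible representations with multiplicity at most one, i.e., for every dominant integral weight λ, dim Hom_g(V_λ, V ⊗ W) ≤ 1. -/

import Mathlib

open TensorProduct Module

/-- A vector `v` that spans a `Q`-stable line, where `P + Q` is the whole Lie algebra, generates a
Lie submodule under the action of `P` alone. -/
lemma LieSubmodule.exists_mem_le_of_lie_mem {R L M : Type*} [CommRing R] [LieRing L]
    [LieAlgebra R L] [AddCommGroup M] [Module R M] [LieRingModule L M] [LieModule R L M]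
    {P Q : Submodule R L} (hPQ : P ⊔ Q = ⊤) {v : M}
    (hQ : ∀ y ∈ Q, ⁅y, v⁆ ∈ Submodule.span R {v})
    {K : Submodule R M} (hv : v ∈ K) (hP : ∀ x ∈ P, ∀ m ∈ K, ⁅x, m⁆ ∈ K) :
    ∃ N : LieSubmodule R L M, v ∈ N ∧ N.toSubmodule ≤ K := by
  let F : ℕ → Submodule R M := fun k ↦ Nat.rec (Submodule.span R {v})
    (fun _ S ↦ S ⊔ Submodule.span R {n | ∃ x ∈ P, ∃ m ∈ S, ⁅x, m⁆ = n}) k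
  have hF (k : ℕ) : F (k + 1) = F k ⊔ Submodule.span R {n | ∃ x ∈ P, ∃ m ∈ F k, ⁅x, m⁆ = n} := rfl
  have hmono : Monotone F := monotone_nat_of_le_succ fun k ↦ (hF k).symm ▸ le_sup_left
  have hPF {k : ℕ} {x : L} {m : M} (hx : x ∈ P) (hm : m ∈ F k) : ⁅x, m⁆ ∈ F (k + 1) :=
    (hF k).symm ▸ Submodule.mem_sup_right (Submodule.subset_span ⟨x, hx, m, hm, rfl⟩)
  have hQF (k : ℕ) : ∀ y ∈ Q, ∀ m ∈ F k, ⁅y, m⁆ ∈ F k := by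
    induction k with
    | zero =>
      intro y hy m hm
      obtain ⟨c, rfl⟩ := Submodule.mem_span_singleton.1 (show m ∈ Submodule.span R {v} from hm)
      rw [lie_smul]
      exact Submodule.smul_mem _ c (hQ y hy)
    | succ k ih =>
      intro y hy
      suffices F (k + 1) ≤ (F (k + 1)).comap (LieModule.toEnd R L M y) from fun m hm ↦ this hm
      conv_lhs => rw [hF]
      refine sup_le (fun m hm ↦ hmono k.le_succ (ih y hy m hm)) (Submodule.span_le.2 ?_)
      rintro _ ⟨x, hx, m, hm, rfl⟩
      obtain ⟨p, hp, q, hq, hpq⟩ :=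
        Submodule.mem_sup.1 (hPQ ▸ Submodule.mem_top : ⁅y, x⁆ ∈ P ⊔ Q)
      change ⁅y, ⁅x, m⁆⁆ ∈ F (k + 1)
      rw [leibniz_lie, ← hpq, add_lie]
      exact add_mem (add_mem (hPF hp hm) (hmono k.le_succ (ih q hq m hm))) (hPF hx (ih y hy m hm))
  have hFK (k : ℕ) : F k ≤ K := by
    induction k with
    | zero => exact (Submodule.span_singleton_le_iff_mem _ _).2 hv
    | succ k ih =>
      rw [hF]
      refine sup_le ih (Submodule.span_le.2 ?_)
      rintro _ ⟨x, hx, m, hm, rfl⟩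
      exact hP x hx m (ih hm)
  have hdir : Directed (· ≤ ·) F := hmono.directed_le
  refine ⟨{ toSubmodule := ⨆ k, F k, lie_mem := ?_ },
    Submodule.mem_iSup_of_mem (p := F) 0 (Submodule.mem_span_singleton_self v), iSup_le hFK⟩
  intro z m hm
  obtain ⟨k, hk⟩ := (Submodule.mem_iSup_of_directed F hdir).1 hm
  obtain ⟨p, hp, q, hq, rfl⟩ := Submodule.mem_sup.1 (hPQ ▸ Submodule.mem_top : z ∈ P ⊔ Q)
  rw [add_lie]
  exact Submodule.mem_iSup_of_mem (k + 1) (add_mem (hPF hp hk) (hmono k.le_succ (hQF k q hq m hk)))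

/-- A Lie-stable space of linear forms on an irreducible module is zero or everything. -/
lemma LieSubmodule.dual_eq_top_of_isIrreducible {K L M : Type*} [Field K] [LieRing L]
    [LieAlgebra K L] [AddCommGroup M] [Module K M] [LieRingModule L M] [LieModule K L M]
    [FiniteDimensional K M] [LieModule.IsIrreducible K L M]
    {N : LieSubmodule K L (M →ₗ[K] K)} {φ : M →ₗ[K] K} (hφ : φ ∈ N) (hφ0 : φ ≠ 0) :
    N.toSubmodule = ⊤ := by
  let A : LieSubmodule K L M :=
    { toSubmodule := Submodule.dualCoannihilator (R := K) (M := M) N.toSubmodule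
      lie_mem := by
        intro x m hm
        change m ∈ Submodule.dualCoannihilator _ at hm
        change ⁅x, m⁆ ∈ Submodule.dualCoannihilator _
        rw [Submodule.mem_dualCoannihilator] at hm ⊢
        intro ψ hψ
        simpa using hm ⁅x, ψ⁆ (N.lie_mem hψ) }
  have hA : A = ⊥ := by
    refine (IsSimpleOrder.eq_bot_or_eq_top A).resolve_right fun h ↦ hφ0 (LinearMap.ext fun m ↦ ?_)
    have hm : m ∈ A := h ▸ LieSubmodule.mem_top m
    exact (Submodule.mem_dualCoannihilator (R := K) m).1 hm φ hφ
  have hA' : Submodule.dualCoannihilator (R := K) (M := M) N.toSubmodule = ⊥ :=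
    congrArg LieSubmodule.toSubmodule hA
  have := Subspace.dualCoannihilator_dualAnnihilator_eq (K := K) (V := M) (W := N.toSubmodule)
  rw [hA', Submodule.dualAnnihilator_bot] at this
  exact this.symm

/-- Contraction of the second tensor factor against a linear form. -/
noncomputable def TensorProduct.contractRightWith {R V W : Type*} [CommRing R] [AddCommGroup V]
    [Module R V] [AddCommGroup W] [Module R W] : (W →ₗ[R] R) →ₗ[R] V ⊗[R] W →ₗ[R] V :=
  (LinearMap.compRight R (TensorProduct.rid R V).toLinearMap).comp (LinearMap.lTensorHom V)

@[simp]
lemma TensorProduct.contractRightWith_tmul {R V W : Type*} [CommRing R] [AddCommGroup V]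
    [Module R V] [AddCommGroup W] [Module R W] (φ : W →ₗ[R] R) (v : V) (w : W) :
    contractRightWith φ (v ⊗ₜ[R] w) = φ w • v := by
  simp [contractRightWith]

lemma TensorProduct.contractRightWith_lie {R L V W : Type*} [CommRing R] [LieRing L]
    [LieAlgebra R L] [AddCommGroup V] [Module R V] [LieRingModule L V] [LieModule R L V]
    [AddCommGroup W] [Module R W] [LieRingModule L W] [LieModule R L W]
    (x : L) (φ : W →ₗ[R] R) (t : V ⊗[R] W) :
    ⁅x, contractRightWith φ t⁆ = contractRightWith ⁅x, φ⁆ t + contractRightWith φ ⁅x, t⁆ := by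
  induction t with
  | zero => simp
  | add s t hs ht => simp only [map_add, lie_add, hs, ht]; abel
  | tmul v w => simp [LieModule.lie_tmul_right]

lemma TensorProduct.eq_zero_of_contractRightWith_eq_zero {R V W : Type*} [CommRing R]
    [AddCommGroup V] [Module R V] [AddCommGroup W] [Module R W] [Module.Free R W]
    {t : V ⊗[R] W} (h : ∀ φ : W →ₗ[R] R, contractRightWith φ t = 0) : t = 0 := by
  let b := Module.Free.chooseBasis R W
  refine (TensorProduct.equivFinsuppOfBasisRight (M := V) b).injective (Finsupp.ext fun i ↦ ?_)
  suffices ∀ s : V ⊗[R] W, TensorProduct.equivFinsuppOfBasisRight (M := V) b s i =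
      contractRightWith (b.coord i) s by rw [this, h, map_zero, Finsupp.zero_apply]
  intro s
  induction s with
  | zero => simp
  | add s t hs ht => simp [hs, ht]
  | tmul v w => simp

/-- Relative to an additive height on weights, every nontrivial finite-dimensional module contains
an `H`-eigenvector killed by all root spaces of positive height. -/
lemma LieModule.exists_ne_zero_lie_eq_zero_of_height_pos {K L : Type*} [Field K] [IsAlgClosed K]
    [CharZero K] [LieRing L] [LieAlgebra K L] (H : LieSubalgebra K L) [LieRing.IsNilpotent H]
    (M : Type*) [AddCommGroup M] [Module K M] [LieRingModule L M] [LieModule K L M]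
    [FiniteDimensional K M] [Nontrivial M] (ht : (H → K) →+ ℝ) :
    ∃ v : M, v ≠ 0 ∧ (∃ χ : H → K, ∀ h : H, ⁅h, v⁆ = χ h • v) ∧
      ∀ α : H → K, 0 < ht α → ∀ x ∈ LieAlgebra.rootSpace H α, ⁅x, v⁆ = 0 := by
  have hfin := LieModule.finite_genWeightSpace_ne_bot K H M
  have hne : {χ : H → K | genWeightSpace M χ ≠ ⊥}.Nonempty := by
    by_contra hempty
    have hbot (χ : H → K) : genWeightSpace M χ = ⊥ := by
      by_contra hχ
      exact hempty ⟨χ, hχ⟩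
    have htop := LieModule.iSup_genWeightSpace_eq_top K H M
    simp only [hbot, iSup_bot] at htop
    exact bot_ne_top htop
  obtain ⟨χ, hχ, hmax⟩ := hfin.exists_maximalFor ht _ hne
  have : Nontrivial (genWeightSpace M χ) := (LieSubmodule.nontrivial_iff_ne_bot K H M).2 hχ
  obtain ⟨ψ, hψ⟩ := LieModule.exists_nontrivial_weightSpace_of_isSolvable K H (genWeightSpace M χ)
  obtain ⟨⟨⟨v, hvχ⟩, hv⟩, hv0⟩ := exists_ne (0 : weightSpace (genWeightSpace M χ) ψ)
  rw [LieModule.mem_weightSpace] at hv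
  refine ⟨v, fun h ↦ hv0 (by ext; exact h), ⟨ψ, fun h ↦ congrArg Subtype.val (hv h)⟩, ?_⟩
  intro α hα x hx
  have hmem := LieAlgebra.lie_mem_genWeightSpace_of_mem_genWeightSpace hx hvχ
  by_contra hne0
  have hαχ : genWeightSpace M (α + χ) ≠ ⊥ := fun hb ↦ hne0 (by simpa [hb] using hmem)
  have := hmax hαχ (by rw [map_add]; linarith)
  rw [map_add] at this
  linarith

/-- There is an additive height on weights for which the Lie algebra is spanned by a Cartan
subalgebra and the root spaces of nonzero height. -/
lemma LieAlgebra.exists_height_iSup_rootSpace_eq_top {L : Type*} [LieRing L] [LieAlgebra ℂ L]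
    [FiniteDimensional ℂ L] (H : LieSubalgebra ℂ L) [H.IsCartanSubalgebra] :
    ∃ ht : (H → ℂ) →+ ℝ,
      (H.toSubmodule ⊔ ⨆ α : {α : H → ℂ // 0 < ht α}, (rootSpace H α.1).toSubmodule) ⊔
      (H.toSubmodule ⊔ ⨆ α : {α : H → ℂ // 0 < (-ht) α}, (rootSpace H α.1).toSubmodule) = ⊤ := by
  have : Finite {α : H → ℂ // LieModule.genWeightSpace L α ≠ ⊥ ∧ α ≠ 0} :=
    ((LieModule.finite_genWeightSpace_ne_bot ℂ H L).subset fun _ h ↦ h.1).to_subtype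
  obtain ⟨f, hf⟩ := Module.exists_dual_forall_apply_ne_zero (K := ℝ)
    (Subtype.val : {α : H → ℂ // LieModule.genWeightSpace L α ≠ ⊥ ∧ α ≠ 0} → H → ℂ)
    fun α ↦ α.2.2
  refine ⟨f.toAddMonoidHom, top_le_iff.1 ?_⟩
  have htop := congrArg LieSubmodule.toSubmodule (LieModule.iSup_genWeightSpace_eq_top ℂ H L)
  rw [LieSubmodule.iSup_toSubmodule, LieSubmodule.top_toSubmodule] at htop
  rw [← htop]
  refine iSup_le fun α ↦ ?_
  by_cases hα : LieModule.genWeightSpace L α = ⊥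
  · simp [hα]
  by_cases hα0 : α = 0
  · subst hα0
    have h0 := congrArg LieSubmodule.toSubmodule (rootSpace_zero_eq ℂ L H)
    rw [LieSubalgebra.coe_toLieSubmodule] at h0
    exact h0.le.trans (le_sup_left.trans le_sup_left)
  rcases (hf ⟨α, hα, hα0⟩).lt_or_gt with h | h
  · exact le_sup_of_le_right (le_sup_of_le_right (le_iSup_of_le
      (⟨α, by simpa using h⟩ : {α : H → ℂ // 0 < (-f.toAddMonoidHom) α}) le_rfl))
  · exact le_sup_of_le_left (le_sup_of_le_right (le_iSup_of_le
      (⟨α, h⟩ : {α : H → ℂ // 0 < f.toAddMonoidHom α}) le_rfl))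

/-- An `H`-eigenvector killed by a family of root spaces spans a line stable under `H` and that
family. -/
lemma LieModule.lie_mem_span_of_mem_sup {K L : Type*} [Field K]
    [LieRing L] [LieAlgebra K L] {H : LieSubalgebra K L} [LieRing.IsNilpotent H]
    {M : Type*} [AddCommGroup M] [Module K M] [LieRingModule L M] [LieModule K L M]
    {ht : (H → K) →+ ℝ} {v : M} {χ : H → K} (hχ : ∀ h : H, ⁅h, v⁆ = χ h • v)
    (hv : ∀ α : H → K, 0 < ht α → ∀ x ∈ LieAlgebra.rootSpace H α, ⁅x, v⁆ = 0) :
    ∀ x ∈ H.toSubmodule ⊔ ⨆ α : {α : H → K // 0 < ht α},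
      (LieAlgebra.rootSpace H α.1).toSubmodule, ⁅x, v⁆ ∈ Submodule.span K {v} := by
  suffices H.toSubmodule ⊔ ⨆ α : {α : H → K // 0 < ht α},
      (LieAlgebra.rootSpace H α.1).toSubmodule ≤
      (Submodule.span K {v}).comap ((LieModule.toEnd K L M : L →ₗ[K] End K M).flip v) from
    fun x hx ↦ this hx
  refine sup_le (fun h hh ↦ ?_) (iSup_le fun α x hx ↦ ?_)
  · exact Submodule.mem_span_singleton.2 ⟨χ ⟨h, hh⟩, (hχ ⟨h, hh⟩).symm⟩
  · change ⁅x, v⁆ ∈ Submodule.span K {v}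
    rw [hv α.1 α.2 x hx]
    exact zero_mem _

/-- Multiplicity-one decompositions: let `g` be a complex semisimple Lie algebra with
Cartan subalgebra `H`, and let `V`, `W` be finite-dimensional `g`-modules such that `W` is
irreducible and all weight spaces of `V` are (at most) one-dimensional.  Then `V ⊗ W`
decomposes with multiplicity at most one: for every finite-dimensional irreducible
`g`-module `U` (i.e. every highest weight module `V_λ` with `λ` dominant integral),
`dim Hom_g(U, V ⊗ W) ≤ 1`. -/
theorem stmt_2 {L : Type*} [LieRing L] [LieAlgebra ℂ L] [FiniteDimensional ℂ L]
    [LieAlgebra.IsSemisimple ℂ L]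
    (H : LieSubalgebra ℂ L) [H.IsCartanSubalgebra]
    (V W U : Type*)
    [AddCommGroup V] [Module ℂ V] [LieRingModule L V] [LieModule ℂ L V]
    [FiniteDimensional ℂ V]
    [AddCommGroup W] [Module ℂ W] [LieRingModule L W] [LieModule ℂ L W]
    [FiniteDimensional ℂ W]
    [AddCommGroup U] [Module ℂ U] [LieRingModule L U] [LieModule ℂ L U]
    [FiniteDimensional ℂ U]
    [LieModule.IsIrreducible ℂ L W] [LieModule.IsIrreducible ℂ L U]
    (hV : ∀ χ : H → ℂ, finrank ℂ (LieModule.genWeightSpace V χ) ≤ 1) :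
    finrank ℂ (U →ₗ⁅ℂ,L⁆ V ⊗[ℂ] W) ≤ 1 := by
  obtain ⟨ht, htop⟩ := LieAlgebra.exists_height_iSup_rootSpace_eq_top H
  have : Nontrivial U := (LieSubmodule.nontrivial_iff ℂ L U).1 inferInstance
  have : Nontrivial W := (LieSubmodule.nontrivial_iff ℂ L W).1 inferInstance
  have : Nontrivial (W →ₗ[ℂ] ℂ) := inferInstanceAs (Nontrivial (Dual ℂ W))
  obtain ⟨u, hu0, ⟨χ, hχ⟩, hu⟩ := LieModule.exists_ne_zero_lie_eq_zero_of_height_pos H U ht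
  obtain ⟨φ, hφ0, ⟨μ, hμ⟩, hφ⟩ :=
    LieModule.exists_ne_zero_lie_eq_zero_of_height_pos H (W →ₗ[ℂ] ℂ) (-ht)
  let T : (U →ₗ⁅ℂ,L⁆ V ⊗[ℂ] W) →ₗ[ℂ] V :=
    { toFun f := contractRightWith φ (f u)
      map_add' f g := by simp
      map_smul' c f := by simp }
  have hT (f : U →ₗ⁅ℂ,L⁆ V ⊗[ℂ] W) :
      T f ∈ (LieModule.genWeightSpace V (μ + χ)).toSubmodule := by
    refine LieModule.weightSpace_le_genWeightSpace V (μ + χ)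
      ((LieModule.mem_weightSpace _ _).2 fun h ↦ ?_)
    have hμ' : ⁅(h : L), φ⁆ = μ h • φ := hμ h
    have hχ' : ⁅(h : L), u⁆ = χ h • u := hχ h
    change ⁅(h : L), contractRightWith φ (f u)⁆ = (μ h + χ h) • contractRightWith φ (f u)
    rw [contractRightWith_lie, ← LieModuleHom.map_lie, hμ', hχ', map_smul, map_smul,
      map_smul, LinearMap.smul_apply, add_smul]
  have hinj : Function.Injective (T.codRestrict _ hT) := by
    rw [← LinearMap.ker_eq_bot, LinearMap.ker_codRestrict, LinearMap.ker_eq_bot']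
    intro f hf
    let K : Submodule ℂ (W →ₗ[ℂ] ℂ) :=
      LinearMap.ker ((contractRightWith (R := ℂ) (V := V) (W := W)).flip (f u))
    have hK {ψ : W →ₗ[ℂ] ℂ} : ψ ∈ K ↔ contractRightWith ψ (f u) = 0 := LinearMap.mem_ker
    obtain ⟨N, hφN, hNK⟩ := LieSubmodule.exists_mem_le_of_lie_mem htop
      (LieModule.lie_mem_span_of_mem_sup hμ hφ) (K := K) (hK.2 hf) (by
        intro x hx ψ hψ
        obtain ⟨c, hc⟩ := Submodule.mem_span_singleton.1
          (LieModule.lie_mem_span_of_mem_sup hχ hu x hx)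
        rw [hK] at hψ ⊢
        have := contractRightWith_lie x ψ (f u)
        rwa [← LieModuleHom.map_lie, ← hc, map_smul, map_smul, hψ, lie_zero,
          smul_zero, add_zero, eq_comm] at this)
    rw [LieSubmodule.dual_eq_top_of_isIrreducible hφN hφ0, top_le_iff] at hNK
    have hfu : f u = 0 := eq_zero_of_contractRightWith_eq_zero fun ψ ↦
      hK.1 (hNK ▸ Submodule.mem_top)
    have hker : f.ker = ⊤ := (IsSimpleOrder.eq_bot_or_eq_top f.ker).resolve_left fun hb ↦
      hu0 ((LieSubmodule.mem_bot u).1 (hb ▸ LieModuleHom.mem_ker.2 hfu))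
    ext m
    exact LieModuleHom.mem_ker.1 (hker ▸ LieSubmodule.mem_top m)
  exact (LinearMap.finrank_le_finrank_of_injective hinj).trans (hV _)
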